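/- Let α be a real number with 3/4 < α ≤ 1, let s ≥ 2 − 2α and N ∈ ℕ ∪ {∞}. There is a constant C_s > 0, depending only on s and α, such that for all sequences u, v, φ : ℤ → ℂ with finite H^s norms one has ∑_{n∈ℤ} ⟨n⟩^{2s} ( ∑ |u(j₁)| |v(j₂)| |φ(j₃)| / (2 |Φ_α(j₁,j₂,j₃)|) )² ≤ C_s ( ‖u‖_{H^s} ‖v‖_{H^s} ‖φ‖_{L²} + ‖u‖_{H^s} ‖v‖_{L²} ‖φ‖_{H^s} + ‖u‖_{L²} ‖v‖_{H^s} ‖φ‖_{H^s} )², where the inner sum runs over integers j₁, j₂, j₃ with j₁ + j₂ − j₃ = n, Φ_α(j₁,j₂,j₃) ≠ 0 and |j₁|, |j₂|, |j₃| ≤ N (the constraints |jᵢ| ≤ N being absent when N = ∞). -/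

import Mathlib

open scoped BigOperators ENNReal ComplexConjugate Classical
open Filter Set MeasureTheory ComplexConjugate

noncomputable section

/-- `ℝ≥0∞`-valued `H^s` norm of a sequence of Fourier coefficients. -/
def hsE (s : ℝ) (u : ℤ → ℂ) : ℝ≥0∞ :=
  (∑' n : ℤ, ENNReal.ofReal (1 + |(n : ℝ)| ^ (2 * s)) * (‖u n‖₊ : ℝ≥0∞) ^ 2) ^ ((1:ℝ)/2)

/-- `ℝ≥0∞`-valued `FL^{0,1}` norm. -/
def flE (u : ℤ → ℂ) : ℝ≥0∞ := ∑' n : ℤ, (‖u n‖₊ : ℝ≥0∞)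

/-- real-valued `H^s` norm. -/
def hsR (s : ℝ) (u : ℤ → ℂ) : ℝ :=
  Real.sqrt (∑' n : ℤ, (1 + |(n : ℝ)| ^ (2 * s)) * ‖u n‖ ^ 2)

/-- real-valued `FL^{0,1}` norm. -/
def flR (u : ℤ → ℂ) : ℝ := ∑' n : ℤ, ‖u n‖

/-- The condition `|j| ≤ N` for `N ∈ ℕ ∪ {∞}`. -/
def inBall (N : ℕ∞) (j : ℤ) : Prop := (j.natAbs : ℕ∞) ≤ N

/-- The resonance function `Φ_α`. -/
def res (α : ℝ) (j₁ j₂ j₃ : ℤ) : ℝ :=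
  |(j₁ : ℝ)| ^ (2 * α) + |(j₂ : ℝ)| ^ (2 * α) - |(j₃ : ℝ)| ^ (2 * α)
    - |((j₁ + j₂ - j₃ : ℤ) : ℝ)| ^ (2 * α)

/-- The (truncated) Birkhoff vector field `X_N`. -/
def XB (α σ : ℝ) (N : ℕ∞) (u : ℤ → ℂ) : ℤ → ℂ := fun n =>
  if inBall N n then
    ∑' p : ℤ × ℤ,
      (if inBall N p.1 ∧ inBall N p.2 ∧ inBall N (p.1 + p.2 - n) ∧
          res α p.1 p.2 (p.1 + p.2 - n) ≠ 0 then
        ((-σ / res α p.1 p.2 (p.1 + p.2 - n) : ℝ) : ℂ) *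
          (u p.1 * u p.2 * conj (u (p.1 + p.2 - n)))
      else 0)
  else 0

/-- Truncation `Π_N`. -/
def trunc (N : ℕ) (u : ℤ → ℂ) : ℤ → ℂ := fun n => if n.natAbs ≤ N then u n else 0

/-- Derivative of a curve at `t`, in the `H^s` norm. -/
def HasHsDerivAt (s : ℝ) (u : ℝ → ℤ → ℂ) (d : ℤ → ℂ) (t : ℝ) : Prop :=
  Tendsto (fun h : ℝ => hsE s (fun n => (u (t + h) n - u t n) / (h : ℂ) - d n))
    (nhdsWithin 0 {(0 : ℝ)}ᶜ) (nhds 0)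

/-- Derivative of a curve at `t` within a set `A` of times, in the `H^s` norm. -/
def HasHsDerivWithinAt (s : ℝ) (u : ℝ → ℤ → ℂ) (d : ℤ → ℂ) (A : Set ℝ) (t : ℝ) : Prop :=
  Tendsto (fun h : ℝ => hsE s (fun n => (u (t + h) n - u t n) / (h : ℂ) - d n))
    (nhdsWithin 0 {h : ℝ | t + h ∈ A ∧ h ≠ 0}) (nhds 0)

/-- Continuity of a curve in the `H^s` norm. -/
def ContHs (s : ℝ) (D : ℝ → ℤ → ℂ) : Prop :=
  ∀ t : ℝ, Tendsto (fun t' => hsE s (fun n => D t' n - D t n)) (nhds t) (nhds 0)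

/-- Continuity of a curve in the `H^s` norm, on a set of times. -/
def ContHsOn (s : ℝ) (A : Set ℝ) (D : ℝ → ℤ → ℂ) : Prop :=
  ∀ t ∈ A, Tendsto (fun t' => hsE s (fun n => D t' n - D t n)) (nhdsWithin t A) (nhds 0)

/-- `u` is a global-in-time solution of `d/dt u = X_N(u)`, as a curve in `H^s`. -/
def IsSol (α σ : ℝ) (N : ℕ∞) (s : ℝ) (u : ℝ → ℤ → ℂ) : Prop :=
  ∀ t : ℝ, hsE s (u t) ≠ ⊤ ∧ HasHsDerivAt s u (XB α σ N (u t)) t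

/-- `u` solves `d/dt u = X_N(u)` on the set of times `A`, as a curve in `H^s`. -/
def IsSolOn (α σ : ℝ) (N : ℕ∞) (s : ℝ) (A : Set ℝ) (u : ℝ → ℤ → ℂ) : Prop :=
  ∀ t ∈ A, hsE s (u t) ≠ ⊤ ∧ HasHsDerivWithinAt s u (XB α σ N (u t)) A t

/-- `u` is a global-in-time continuously differentiable solution, as a curve in `H^s`. -/
def IsC1Sol (α σ : ℝ) (N : ℕ∞) (s : ℝ) (u : ℝ → ℤ → ℂ) : Prop :=
  IsSol α σ N s u ∧ ContHs s (fun t => XB α σ N (u t))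

/-- `u` is a continuously differentiable solution on the set of times `A`. -/
def IsC1SolOn (α σ : ℝ) (N : ℕ∞) (s : ℝ) (A : Set ℝ) (u : ℝ → ℤ → ℂ) : Prop :=
  IsSolOn α σ N s A u ∧ ContHsOn s A (fun t => XB α σ N (u t))

/-- integer modes in `[-N, N]`. -/
def Ifin (N : ℕ) : Finset ℤ := Finset.Icc (-(N:ℤ)) (N:ℤ)

/-- The quartic form `‖Π_N u‖⁴_{L⁴}`. -/
def qL4 (N : ℕ) (u : ℤ → ℂ) : ℝ :=
  (∑ j₁ ∈ Ifin N, ∑ j₂ ∈ Ifin N, ∑ j₃ ∈ Ifin N, ∑ j₄ ∈ Ifin N,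
    if j₁ + j₂ = j₃ + j₄ then u j₁ * u j₂ * conj (u j₃) * conj (u j₄) else 0).re

/-- `G_N(u)`, the derivative at `t = 0` of the energy along the truncated Birkhoff flow. -/
def GN (α σ : ℝ) (N : ℕ) (u : ℤ → ℂ) : ℝ :=
  -(σ/2) * qL4 N u + σ * (∑ j ∈ Ifin N, ‖u j‖^2)^2
  + 2 * σ * (∑ n₁ ∈ Ifin N, ∑ n₂ ∈ Ifin N, ∑ m₁ ∈ Ifin N, ∑ m₂ ∈ Ifin N,
      if n₁ + n₂ = m₁ + m₂ then
        XB α σ (N : ℕ∞) (trunc N u) n₁ * u n₂ * conj (u m₁) * conj (u m₂)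
      else 0).re

/-- Quantitative concavity of `x ↦ x ^ q` on `[0, R]`, for `0 < q ≤ 1`. -/
theorem mul_sub_le_rpow_sub_rpow {q R x y : ℝ} (hq0 : 0 < q) (hq1 : q ≤ 1) (hx : 0 ≤ x)
    (hxy : x ≤ y) (hy : 0 < y) (hyR : y ≤ R) :
    q * R ^ (q - 1) * (y - x) ≤ y ^ q - x ^ q := by
  have h1 : (x / y) ^ q ≤ 1 + q * (x / y - 1) := by
    have := rpow_one_add_le_one_add_mul_self (s := x / y - 1)
      (by have : 0 ≤ x / y := by positivity
          linarith) hq0.le hq1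
    simpa using this
  have h2 : R ^ (q - 1) ≤ y ^ (q - 1) :=
    Real.rpow_le_rpow_of_nonpos hy hyR (by linarith)
  rw [Real.div_rpow hx hy.le, div_le_iff₀ (by positivity)] at h1
  have h3 : y ^ q = y ^ (q - 1) * y := by
    rw [← Real.rpow_add_one hy.ne']; ring_nf
  have h4 : (1 + q * (x / y - 1)) * y ^ q = y ^ q - q * y ^ (q - 1) * (y - x) := by
    rw [h3]; field_simp; ring
  have h5 : q * R ^ (q - 1) * (y - x) ≤ q * y ^ (q - 1) * (y - x) := by
    have : 0 ≤ y - x := by linarith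
    gcongr
  linarith

theorem abs_rpow_sub_two_mul_self {p x : ℝ} (hp : 1 < p) (hx : 0 ≤ x) :
    |x| ^ (p - 2) * x = x ^ (p - 1) := by
  rcases hx.eq_or_lt with rfl | hx
  · rw [mul_zero, Real.zero_rpow (by linarith)]
  · rw [abs_of_pos hx, ← Real.rpow_add_one hx.ne']; ring_nf

/-- `|x| ^ p - κ x ^ 2` is convex on `[-R, R]` for the optimal `κ`, when `1 < p ≤ 2`. -/
theorem convexOn_abs_rpow_sub_sq {p R : ℝ} (hp1 : 1 < p) (hp2 : p ≤ 2) :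
    ConvexOn ℝ (Icc (-R) R)
      (fun x : ℝ => |x| ^ p - p * (p - 1) / 2 * R ^ (p - 2) * x ^ 2) := by
  have hd : ∀ x : ℝ, HasDerivAt
      (fun x : ℝ => |x| ^ p - p * (p - 1) / 2 * R ^ (p - 2) * x ^ 2)
      (p * (|x| ^ (p - 2) * x - (p - 1) * R ^ (p - 2) * x)) x := by
    intro x
    convert! (hasDerivAt_abs_rpow x hp1).sub
      ((hasDerivAt_pow 2 x).const_mul (p * (p - 1) / 2 * R ^ (p - 2))) using 1
    push_cast; ring
  have key : ∀ x y : ℝ, 0 ≤ x → x ≤ y → y ≤ R →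
      |x| ^ (p - 2) * x - (p - 1) * R ^ (p - 2) * x
        ≤ |y| ^ (p - 2) * y - (p - 1) * R ^ (p - 2) * y := by
    intro x y hx hxy hy
    rcases hxy.eq_or_lt with rfl | hlt
    · exact le_rfl
    have := mul_sub_le_rpow_sub_rpow (q := p - 1) (by linarith) (by linarith) hx hxy
      (by linarith) hy
    rw [abs_rpow_sub_two_mul_self hp1 hx, abs_rpow_sub_two_mul_self hp1 (hx.trans hxy)]
    rw [show p - 1 - 1 = p - 2 by ring] at this
    linarith
  refine MonotoneOn.convexOn_of_deriv (convex_Icc _ _)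
    (fun x _ => (hd x).continuousAt.continuousWithinAt)
    (fun x _ => (hd x).differentiableAt.differentiableWithinAt) ?_
  intro x hx y hy hxy
  rw [(hd x).deriv, (hd y).deriv]
  have hx' := interior_subset hx
  have hy' := interior_subset hy
  refine mul_le_mul_of_nonneg_left ?_ (by linarith)
  rcases le_total 0 x with h0x | hx0
  · exact key x y h0x hxy hy'.2
  rcases le_total 0 y with h0y | hy0
  · have h1 := key 0 y le_rfl h0y hy'.2
    have h2 := key 0 (-x) le_rfl (by linarith) (by linarith [hx'.1])
    simp only [abs_neg, mul_zero, sub_zero] at h1 h2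
    linarith
  · have := key (-y) (-x) (by linarith) (by linarith) (by linarith [hx'.1])
    simp only [abs_neg] at this
    linarith

theorem ConvexOn.add_le_add_of_add_eq {D : Set ℝ} {g : ℝ → ℝ} (hg : ConvexOn ℝ D g)
    {x y z w : ℝ} (hx : x ∈ D) (hw : w ∈ D) (hxy : x ≤ y) (hyw : y ≤ w) (h : y + z = x + w) :
    g y + g z ≤ g x + g w := by
  rcases (hxy.trans hyw).eq_or_lt with rfl | hlt
  · obtain rfl : y = x := le_antisymm hyw hxy
    obtain rfl : z = y := by linarith
    exact le_rfl
  have hd : 0 < w - x := sub_pos.2 hlt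
  have ha : 0 ≤ (w - y) / (w - x) := div_nonneg (by linarith) hd.le
  have hb : 0 ≤ (y - x) / (w - x) := div_nonneg (by linarith) hd.le
  have hab : (w - y) / (w - x) + (y - x) / (w - x) = 1 := by field_simp; ring
  have h1 := hg.2 hx hw ha hb hab
  have h2 := hg.2 hx hw hb ha (by linarith)
  simp only [smul_eq_mul] at h1 h2
  rw [show (w - y) / (w - x) * x + (y - x) / (w - x) * w = y by field_simp; ring] at h1
  rw [show (y - x) / (w - x) * x + (w - y) / (w - x) * w = z by
    rw [show z = x + w - y by linarith]; field_simp; ring] at h2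
  linear_combination h1 + h2 + (g x + g w) * hab

/-- Lower bound for the second difference of `|x| ^ p`, `1 < p ≤ 2`. -/
theorem mul_abs_mul_le_abs_second_difference {p R x y z w : ℝ} (hp1 : 1 < p) (hp2 : p ≤ 2)
    (hx : |x| ≤ R) (hy : |y| ≤ R) (hz : |z| ≤ R) (hw : |w| ≤ R) (h : y + z = x + w) :
    p * (p - 1) * R ^ (p - 2) * (|y - x| * |z - x|)
      ≤ |(|y| ^ p + |z| ^ p - |x| ^ p - |w| ^ p)| := by
  have hc := convexOn_abs_rpow_sub_sq (R := R) hp1 hp2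
  rw [abs_le] at hx hy hz hw
  have hw' : w = y + z - x := by linarith
  rw [← abs_mul]
  rcases le_total x y with h1 | h1 <;> rcases le_total x z with h2 | h2
  · have := hc.add_le_add_of_add_eq hx hw h1 (by linarith) h
    rw [abs_of_nonneg (mul_nonneg (by linarith) (by linarith))]
    refine le_trans ?_ (neg_le_abs _)
    subst hw'; linear_combination this
  · have := hc.add_le_add_of_add_eq (x := z) (w := y) (y := x) (z := w) hz hy h2 h1 (by linarith)
    rw [abs_of_nonpos (mul_nonpos_of_nonneg_of_nonpos (by linarith) (by linarith))]
    refine le_trans ?_ (le_abs_self _)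
    subst hw'; linear_combination this
  · have := hc.add_le_add_of_add_eq (x := y) (w := z) (y := x) (z := w) hy hz h1 h2 (by linarith)
    rw [abs_of_nonpos (mul_nonpos_of_nonpos_of_nonneg (by linarith) (by linarith))]
    refine le_trans ?_ (le_abs_self _)
    subst hw'; linear_combination this
  · have := hc.add_le_add_of_add_eq (x := w) (w := x) (y := y) (z := z) hw hx (by linarith) h1
      (by linarith)
    rw [abs_of_nonneg (mul_nonneg_of_nonpos_of_nonpos (by linarith) (by linarith))]
    refine le_trans ?_ (neg_le_abs _)
    subst hw'; linear_combination this

/-- The square root of the weight defining `hsE s`. -/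
def hsWeight (s x : ℝ) : ℝ := Real.sqrt (1 + |x| ^ (2 * s))

theorem one_le_hsWeight (s x : ℝ) : 1 ≤ hsWeight s x := by
  rw [hsWeight, Real.one_le_sqrt]
  linarith [Real.rpow_nonneg (abs_nonneg x) (2 * s)]

theorem abs_rpow_le_hsWeight (s x : ℝ) : |x| ^ s ≤ hsWeight s x := by
  refine Real.le_sqrt_of_sq_le ?_
  rw [← Real.rpow_mul_natCast (abs_nonneg x), Nat.cast_ofNat, mul_comm s]
  linarith

/-- A factor `|x| ^ γ` is absorbed either by the distance from `x` to `y` or by the weight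
of `y`. -/
theorem rpow_mul_rpow_le_weights {γ s x y d e : ℝ} (hγ : 0 ≤ γ) (hγs : γ ≤ s)
    (hxy : |x| ≤ d + |y|) (hd : 1 ≤ d) (he : 1 ≤ e) (hx : 1 ≤ |x|) (hy : y = 0 ∨ 1 ≤ |y|) :
    |x| ^ s * |x| ^ γ ≤ 2 ^ γ * (d ^ γ * e ^ γ) * (hsWeight s x * hsWeight s y) := by
  have hd1 : 1 ≤ d ^ γ := Real.one_le_rpow hd hγ
  have he1 : 1 ≤ e ^ γ := Real.one_le_rpow he hγ
  have hde : 1 ≤ d ^ γ * e ^ γ := one_le_mul_of_one_le_of_one_le hd1 he1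
  have hwx := one_le_hsWeight s x
  have hwy := one_le_hsWeight s y
  suffices h : |x| ^ γ ≤ 2 ^ γ * (d ^ γ * e ^ γ) * hsWeight s y by
    calc |x| ^ s * |x| ^ γ
        ≤ hsWeight s x * (2 ^ γ * (d ^ γ * e ^ γ) * hsWeight s y) := by
          gcongr
          exact abs_rpow_le_hsWeight s x
      _ = _ := by ring
  have h2 : (0:ℝ) < 2 ^ γ := by positivity
  rcases le_total |x| (2 * d) with h | h
  · calc |x| ^ γ ≤ (2 * d) ^ γ := by gcongr
      _ = 2 ^ γ * (d ^ γ * 1) * 1 := by rw [Real.mul_rpow (by norm_num) (by linarith)]; ring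
      _ ≤ _ := by gcongr
  · have hy1 : 1 ≤ |y| := by
      rcases hy with rfl | hy
      · rw [abs_zero] at hxy; linarith
      · exact hy
    calc |x| ^ γ ≤ (2 * |y|) ^ γ := by gcongr; linarith
      _ = 2 ^ γ * 1 * |y| ^ γ := by rw [Real.mul_rpow (by norm_num) (abs_nonneg _)]; ring
      _ ≤ 2 ^ γ * (d ^ γ * e ^ γ) * |y| ^ s := by
          gcongr
      _ ≤ _ := by
          gcongr
          exact abs_rpow_le_hsWeight s y

/-- The sum of the products of two of the three weights. -/
def hsPairWeight (s x y z : ℝ) : ℝ :=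
  hsWeight s x * hsWeight s y + hsWeight s x * hsWeight s z + hsWeight s y * hsWeight s z

theorem max_rpow_mul_rpow_le {γ s : ℝ} {i j k : ℤ} (hγ : 0 ≤ γ) (hγs : γ ≤ s)
    (hik : i ≠ k) (hjk : j ≠ k) :
    ∃ M : ℝ, 1 ≤ M ∧ |(i : ℝ)| ≤ M ∧ |(j : ℝ)| ≤ M ∧ |(k : ℝ)| ≤ M ∧
      M ^ s * M ^ γ ≤ 2 ^ γ * (|(i - k : ℝ)| ^ γ * |(j - k : ℝ)| ^ γ) *
        hsPairWeight s i j k := by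
  have one_le : ∀ m : ℤ, m ≠ 0 → 1 ≤ |(m : ℝ)| := fun m hm => by
    exact_mod_cast Int.one_le_abs hm
  have dich : ∀ m : ℤ, (m : ℝ) = 0 ∨ 1 ≤ |(m : ℝ)| := fun m => by
    rcases eq_or_ne m 0 with rfl | h
    · exact Or.inl (by simp)
    · exact Or.inr (one_le m h)
  have hd : 1 ≤ |(i - k : ℝ)| := by exact_mod_cast one_le (i - k) (sub_ne_zero.2 hik)
  have he : 1 ≤ |(j - k : ℝ)| := by exact_mod_cast one_le (j - k) (sub_ne_zero.2 hjk)
  have t1 : |(i : ℝ)| ≤ |(i - k : ℝ)| + |(k : ℝ)| := by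
    simpa using abs_add_le (i - k : ℝ) k
  have t2 : |(j : ℝ)| ≤ |(j - k : ℝ)| + |(k : ℝ)| := by
    simpa using abs_add_le (j - k : ℝ) k
  have t3 : |(k : ℝ)| ≤ |(i - k : ℝ)| + |(i : ℝ)| := by
    rw [abs_sub_comm]; simpa using abs_add_le (k - i : ℝ) i
  have hpos : ∀ x : ℝ, 0 < hsWeight s x := fun x => one_pos.trans_le (one_le_hsWeight s x)
  have pij := mul_pos (hpos i) (hpos j)
  have pik := mul_pos (hpos i) (hpos k)
  have pjk := mul_pos (hpos j) (hpos k)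
  have hne : (i : ℝ) ≠ 0 ∨ (k : ℝ) ≠ 0 := by
    by_contra! h
    exact hik (by exact_mod_cast h.1.trans h.2.symm)
  have hmax : 1 ≤ |(i : ℝ)| ∨ 1 ≤ |(k : ℝ)| :=
    hne.imp (dich i).resolve_left (dich k).resolve_left
  have hcases : (|(j : ℝ)| ≤ |(i : ℝ)| ∧ |(k : ℝ)| ≤ |(i : ℝ)|) ∨
      (|(i : ℝ)| ≤ |(j : ℝ)| ∧ |(k : ℝ)| ≤ |(j : ℝ)|) ∨
      (|(i : ℝ)| ≤ |(k : ℝ)| ∧ |(j : ℝ)| ≤ |(k : ℝ)|) := by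
    grind
  rcases hcases with ⟨h1, h2⟩ | ⟨h1, h2⟩ | ⟨h1, h2⟩
  · have hM : 1 ≤ |(i : ℝ)| := hmax.elim id (fun h => h.trans h2)
    refine ⟨_, hM, le_rfl, h1, h2, ?_⟩
    refine (rpow_mul_rpow_le_weights hγ hγs t1 hd he hM (dich k)).trans ?_
    gcongr
    rw [hsPairWeight]; linarith
  · have hM : 1 ≤ |(j : ℝ)| := hmax.elim (fun h => h.trans h1) (fun h => h.trans h2)
    refine ⟨_, hM, h1, le_rfl, h2, ?_⟩
    refine (rpow_mul_rpow_le_weights hγ hγs t2 he hd hM (dich k)).trans ?_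
    rw [mul_comm (|(j - k : ℝ)| ^ γ)]
    gcongr
    rw [hsPairWeight]; linarith
  · have hM : 1 ≤ |(k : ℝ)| := hmax.elim (fun h => h.trans h1) id
    refine ⟨_, hM, h1, h2, le_rfl, ?_⟩
    refine (rpow_mul_rpow_le_weights hγ hγs t3 hd he hM (dich i)).trans ?_
    gcongr
    rw [hsPairWeight]; linarith

/-- The constant in the pointwise bound for the kernel. -/
def kernelConst (α s : ℝ) : ℝ :=
  10 ^ (s / 2) * 3 ^ (2 - 2 * α) * 2 ^ (2 - 2 * α) / (2 * (2 * α * (2 * α - 1)))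

theorem weight_div_res_le {α s : ℝ} (hα₁ : 1 / 2 < α) (hα₂ : α ≤ 1) (hs : 2 - 2 * α ≤ s)
    {i j k n : ℤ} (hn : i + j - k = n) (hres : res α i j k ≠ 0) :
    (1 + (n : ℝ) ^ 2) ^ (s / 2) / (2 * |res α i j k|) ≤
      kernelConst α s * (|(i - k : ℝ)| ^ (-(2 * α - 1)) * |(j - k : ℝ)| ^ (-(2 * α - 1))) *
        hsPairWeight s i j k := by
  have hik : i ≠ k := by
    rintro rfl
    apply hres
    simp [res]
  have hjk : j ≠ k := by
    rintro rfl
    apply hres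
    simp [res]
  have hs0 : 0 ≤ s := by linarith
  obtain ⟨M, hM1, hiM, hjM, hkM, hM⟩ :=
    max_rpow_mul_rpow_le (γ := 2 - 2 * α) (by linarith) hs hik hjk
  have hnr : (n : ℝ) = i + j - k := by rw [← hn]; push_cast; ring
  have hnM : |(n : ℝ)| ≤ 3 * M := by
    rw [hnr]
    rw [abs_le] at *
    constructor <;> linarith
  have hda : 0 < |(i - k : ℝ)| := abs_pos.2 (sub_ne_zero.2 (by exact_mod_cast hik))
  have hdb : 0 < |(j - k : ℝ)| := abs_pos.2 (sub_ne_zero.2 (by exact_mod_cast hjk))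
  have hlow : 2 * α * (2 * α - 1) * (3 * M) ^ (2 * α - 2) *
      (|(i - k : ℝ)| * |(j - k : ℝ)|) ≤ |res α i j k| := by
    have := mul_abs_mul_le_abs_second_difference (p := 2 * α) (R := 3 * M) (x := k) (y := i)
      (z := j) (w := n) (by linarith) (by linarith) (by linarith) (by linarith) (by linarith)
      hnM (by rw [hnr]; ring)
    rw [res, hn]
    exact this
  have hup : (1 + (n : ℝ) ^ 2) ^ (s / 2) ≤ 10 ^ (s / 2) * M ^ s := by
    have h1 : 1 + (n : ℝ) ^ 2 ≤ 10 * M ^ 2 := by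
      rw [← sq_abs]
      nlinarith [abs_nonneg (n : ℝ)]
    calc (1 + (n : ℝ) ^ 2) ^ (s / 2) ≤ (10 * M ^ 2) ^ (s / 2) := by gcongr
      _ = _ := by
        rw [Real.mul_rpow (by norm_num) (by positivity), ← Real.rpow_natCast_mul (by linarith)]
        congr 2; push_cast; ring
  have hM0 : 0 < M := by linarith
  have hc : 0 < 2 * α * (2 * α - 1) := mul_pos (by linarith) (by linarith)
  have hdiv : ∀ x : ℝ, 0 < x → x ^ (-(2 * α - 1)) = x ^ (2 - 2 * α) / x := fun x hx => by
    rw [← Real.rpow_sub_one hx.ne']; congr 1; ring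
  have hneg : (3 * M) ^ (2 * α - 2) = (3 ^ (2 - 2 * α) * M ^ (2 - 2 * α))⁻¹ := by
    rw [← Real.mul_rpow (by norm_num) hM0.le, ← Real.rpow_neg (by positivity)]
    congr 1; ring
  rw [hneg] at hlow
  calc (1 + (n : ℝ) ^ 2) ^ (s / 2) / (2 * |res α i j k|)
      ≤ (10 ^ (s / 2) * M ^ s) / (2 * (2 * α * (2 * α - 1) *
          (3 ^ (2 - 2 * α) * M ^ (2 - 2 * α))⁻¹ * (|(i - k : ℝ)| * |(j - k : ℝ)|))) := by
        gcongr
    _ = 10 ^ (s / 2) * 3 ^ (2 - 2 * α) / (2 * (2 * α * (2 * α - 1))) /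
          (|(i - k : ℝ)| * |(j - k : ℝ)|) * (M ^ s * M ^ (2 - 2 * α)) := by
        field_simp
    _ ≤ 10 ^ (s / 2) * 3 ^ (2 - 2 * α) / (2 * (2 * α * (2 * α - 1))) /
          (|(i - k : ℝ)| * |(j - k : ℝ)|) * (2 ^ (2 - 2 * α) *
          (|(i - k : ℝ)| ^ (2 - 2 * α) * |(j - k : ℝ)| ^ (2 - 2 * α)) *
          hsPairWeight s i j k) := by
        gcongr
    _ = _ := by
        rw [hdiv _ hda, hdiv _ hdb, kernelConst]
        field_simp

theorem ENNReal.tsum_mul_sq_le {ι : Type*} (f g : ι → ℝ≥0∞) :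
    (∑' i, f i * g i) ^ 2 ≤ (∑' i, f i ^ 2) * ∑' i, g i ^ 2 := by
  have h : ∑' i, f i * g i ≤
      (∑' i, f i ^ 2) ^ (1 / 2 : ℝ) * (∑' i, g i ^ 2) ^ (1 / 2 : ℝ) := by
    rw [ENNReal.tsum_eq_iSup_sum]
    refine iSup_le fun t => ?_
    refine (ENNReal.inner_le_Lp_mul_Lq t f g (Real.HolderConjugate.two_two)).trans ?_
    simp only [ENNReal.rpow_two]
    gcongr <;> exact ENNReal.sum_le_tsum t
  calc _ ≤ ((∑' i, f i ^ 2) ^ (1 / 2 : ℝ) * (∑' i, g i ^ 2) ^ (1 / 2 : ℝ)) ^ 2 := by gcongr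
    _ = _ := by
      rw [mul_pow, ← ENNReal.rpow_mul_natCast, ← ENNReal.rpow_mul_natCast]
      norm_num

theorem ENNReal.add_add_sq_le (x y z : ℝ≥0∞) :
    (x + y + z) ^ 2 ≤ 9 * (x ^ 2 + y ^ 2 + z ^ 2) := by
  have key : ∀ m : ℝ≥0∞, x ≤ m → y ≤ m → z ≤ m → (x + y + z) ^ 2 ≤ 9 * m ^ 2 :=
    fun m hx hy hz => by
      calc (x + y + z) ^ 2 ≤ (m + m + m) ^ 2 := by gcongr
        _ = 9 * m ^ 2 := by ring
  have hcases : (y ≤ x ∧ z ≤ x) ∨ (x ≤ y ∧ z ≤ y) ∨ (x ≤ z ∧ y ≤ z) := by grind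
  rcases hcases with ⟨h1, h2⟩ | ⟨h1, h2⟩ | ⟨h1, h2⟩
  · exact (key x le_rfl h1 h2).trans (by gcongr; rw [add_assoc]; exact le_self_add)
  · exact (key y h1 le_rfl h2).trans (by gcongr; rw [add_right_comm]; exact le_add_self)
  · exact (key z h1 h2 le_rfl).trans (by gcongr; exact le_add_self)

theorem tsum_tsum_trilinear_sq (f g h : ℤ → ℝ≥0∞) :
    ∑' n : ℤ, ∑' p : ℤ × ℤ, (f p.1 * g p.2 * h (p.1 + p.2 - n)) ^ 2 =
      (∑' i, f i ^ 2) * (∑' j, g j ^ 2) * ∑' k, h k ^ 2 := by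
  rw [ENNReal.tsum_comm]
  have hshift : ∀ p : ℤ × ℤ, ∑' n : ℤ, h (p.1 + p.2 - n) ^ 2 = ∑' k, h k ^ 2 := fun p =>
    (Equiv.subLeft (p.1 + p.2)).tsum_eq fun k => h k ^ 2
  simp_rw [mul_pow, ENNReal.tsum_mul_left, hshift, ENNReal.tsum_mul_right]
  rw [ENNReal.tsum_prod']
  simp_rw [ENNReal.tsum_mul_left, ENNReal.tsum_mul_right]

theorem tsum_kernel_sq (f : ℤ → ℝ≥0∞) (n : ℤ) :
    ∑' p : ℤ × ℤ, (f (n - p.2) * f (n - p.1)) ^ 2 = (∑' m, f m ^ 2) ^ 2 := by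
  have hshift : ∑' i : ℤ, f (n - i) ^ 2 = ∑' m, f m ^ 2 :=
    (Equiv.subLeft n).tsum_eq fun m => f m ^ 2
  rw [ENNReal.tsum_prod']
  simp_rw [mul_pow, ENNReal.tsum_mul_right, hshift, ENNReal.tsum_mul_left, hshift, sq]

theorem tsum_ofReal_abs_rpow_sq_ne_top {β : ℝ} (hβ : 1 / 2 < β) :
    ∑' m : ℤ, ENNReal.ofReal (|(m : ℝ)| ^ (-β)) ^ 2 ≠ ⊤ := by
  have h : ∀ m : ℤ, ENNReal.ofReal (|(m : ℝ)| ^ (-β)) ^ 2 =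
      ENNReal.ofReal (|(m : ℝ)| ^ (-(2 * β))) := fun m => by
    rw [← ENNReal.ofReal_pow (by positivity), ← Real.rpow_mul_natCast (abs_nonneg _)]
    congr 2; push_cast; ring
  simp_rw [h]
  exact (Real.summable_abs_int_rpow (by linarith)).tsum_ofReal_ne_top

theorem hsE_sq (s : ℝ) (u : ℤ → ℂ) :
    hsE s u ^ 2 = ∑' n : ℤ, (ENNReal.ofReal (hsWeight s n) * ‖u n‖ₑ) ^ 2 := by
  rw [hsE, ← ENNReal.rpow_mul_natCast]
  norm_num
  refine tsum_congr fun n => ?_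
  rw [mul_pow, hsWeight, ← ENNReal.ofReal_pow (Real.sqrt_nonneg _), Real.sq_sqrt (by positivity)]
  rfl

theorem tsum_enorm_sq_le_hsE_zero_sq (u : ℤ → ℂ) :
    ∑' n : ℤ, ‖u n‖ₑ ^ 2 ≤ hsE 0 u ^ 2 := by
  rw [hsE_sq]
  refine ENNReal.tsum_le_tsum fun n => ?_
  gcongr
  refine le_mul_of_one_le_left' ?_
  exact ENNReal.one_le_ofReal.2 (one_le_hsWeight 0 n)

/-- The trilinear estimate for a product kernel. -/
theorem tsum_sq_tsum_kernel_le (s : ℝ) (κ : ℤ → ℝ≥0∞) (u v φ : ℤ → ℂ) :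
    ∑' n : ℤ, (∑' p : ℤ × ℤ, (κ (n - p.2) * κ (n - p.1)) *
        (ENNReal.ofReal (hsPairWeight s p.1 p.2 (p.1 + p.2 - n : ℤ)) *
          (‖u p.1‖ₑ * ‖v p.2‖ₑ * ‖φ (p.1 + p.2 - n)‖ₑ))) ^ 2 ≤
      (∑' m, κ m ^ 2) ^ 2 * 9 *
        (hsE s u * hsE s v * hsE 0 φ + hsE s u * hsE 0 v * hsE s φ
            + hsE 0 u * hsE s v * hsE s φ) ^ 2 := by
  set U : (ℤ → ℂ) → ℤ → ℝ≥0∞ := fun u n => ENNReal.ofReal (hsWeight s n) * ‖u n‖ₑ with hU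
  set L : (ℤ → ℂ) → ℤ → ℝ≥0∞ := fun u n => ‖u n‖ₑ with hL
  have hw : ∀ x : ℝ, 0 ≤ hsWeight s x := fun x => Real.sqrt_nonneg _
  have split : ∀ (n : ℤ) (p : ℤ × ℤ),
      ENNReal.ofReal (hsPairWeight s p.1 p.2 (p.1 + p.2 - n : ℤ)) *
          (‖u p.1‖ₑ * ‖v p.2‖ₑ * ‖φ (p.1 + p.2 - n)‖ₑ) =
        U u p.1 * U v p.2 * L φ (p.1 + p.2 - n) + U u p.1 * L v p.2 * U φ (p.1 + p.2 - n)
          + L u p.1 * U v p.2 * U φ (p.1 + p.2 - n) := fun n p => by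
    have h12 := mul_nonneg (hw p.1) (hw p.2)
    have h13 := mul_nonneg (hw p.1) (hw (p.1 + p.2 - n : ℤ))
    have h23 := mul_nonneg (hw p.2) (hw (p.1 + p.2 - n : ℤ))
    rw [hsPairWeight, ENNReal.ofReal_add (add_nonneg h12 h13) h23, ENNReal.ofReal_add h12 h13,
      ENNReal.ofReal_mul (hw _), ENNReal.ofReal_mul (hw _), ENNReal.ofReal_mul (hw _)]
    simp only [hU, hL]
    ring
  have hsum : ∀ f g h : ℤ → ℝ≥0∞, ∀ a b c : ℝ≥0∞, ∑' i, f i ^ 2 ≤ a ^ 2 →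
      ∑' i, g i ^ 2 ≤ b ^ 2 → ∑' i, h i ^ 2 ≤ c ^ 2 →
      ∑' n : ℤ, ∑' p : ℤ × ℤ, (f p.1 * g p.2 * h (p.1 + p.2 - n)) ^ 2 ≤ (a * b * c) ^ 2 :=
    fun f g h a b c ha hb hc => by
      rw [tsum_tsum_trilinear_sq, mul_pow, mul_pow]
      gcongr
  have hUs : ∀ w, ∑' i, U w i ^ 2 ≤ hsE s w ^ 2 := fun w => (hsE_sq s w).ge
  have hLs : ∀ w, ∑' i, L w i ^ 2 ≤ hsE 0 w ^ 2 := tsum_enorm_sq_le_hsE_zero_sq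
  simp_rw [split]
  calc _ ≤ ∑' n : ℤ, (∑' m, κ m ^ 2) ^ 2 * ∑' p : ℤ × ℤ,
          9 * ((U u p.1 * U v p.2 * L φ (p.1 + p.2 - n)) ^ 2
            + (U u p.1 * L v p.2 * U φ (p.1 + p.2 - n)) ^ 2
            + (L u p.1 * U v p.2 * U φ (p.1 + p.2 - n)) ^ 2) := by
        refine ENNReal.tsum_le_tsum fun n => (ENNReal.tsum_mul_sq_le _ _).trans ?_
        rw [tsum_kernel_sq]
        gcongr
        exact ENNReal.add_add_sq_le _ _ _
    _ ≤ (∑' m, κ m ^ 2) ^ 2 * (9 * ((hsE s u * hsE s v * hsE 0 φ) ^ 2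
          + (hsE s u * hsE 0 v * hsE s φ) ^ 2 + (hsE 0 u * hsE s v * hsE s φ) ^ 2)) := by
        simp_rw [ENNReal.tsum_mul_left, ENNReal.tsum_add]
        gcongr
        · exact hsum _ _ _ _ _ _ (hUs u) (hUs v) (hLs φ)
        · exact hsum _ _ _ _ _ _ (hUs u) (hLs v) (hUs φ)
        · exact hsum _ _ _ _ _ _ (hLs u) (hUs v) (hUs φ)
    _ ≤ _ := by
        rw [mul_assoc _ (9 : ℝ≥0∞)]
        refine mul_le_mul' le_rfl (mul_le_mul' le_rfl ?_)
        generalize hsE s u * hsE s v * hsE 0 φ = a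
        generalize hsE s u * hsE 0 v * hsE s φ = b
        generalize hsE 0 u * hsE s v * hsE s φ = c
        calc a ^ 2 + b ^ 2 + c ^ 2
            ≤ a ^ 2 + b ^ 2 + c ^ 2 + 2 * (a * b + a * c + b * c) := le_self_add
          _ = (a + b + c) ^ 2 := by ring

/-- Trilinear estimate for the fractional Birkhoff kernel `1/(2|Φ_α|)`, `3/4 < α ≤ 1`. -/
theorem statement_8 (α : ℝ) (hα₁ : 3/4 < α) (hα₂ : α ≤ 1) (s : ℝ) (hs : 2 - 2*α ≤ s) :
    ∃ C : ℝ, 0 < C ∧ ∀ N : ℕ∞, ∀ u v φ : ℤ → ℂ,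
      hsE s u ≠ ⊤ → hsE s v ≠ ⊤ → hsE s φ ≠ ⊤ →
      (∑' n : ℤ, ENNReal.ofReal ((1 + (n : ℝ) ^ 2) ^ s) *
        (∑' p : ℤ × ℤ,
          if res α p.1 p.2 (p.1 + p.2 - n) ≠ 0 ∧
              inBall N p.1 ∧ inBall N p.2 ∧ inBall N (p.1 + p.2 - n) then
            ENNReal.ofReal (‖u p.1‖ * ‖v p.2‖ * ‖φ (p.1 + p.2 - n)‖ /
              (2 * |res α p.1 p.2 (p.1 + p.2 - n)|))
          else 0) ^ 2)
      ≤ ENNReal.ofReal C *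
          (hsE s u * hsE s v * hsE 0 φ + hsE s u * hsE 0 v * hsE s φ
            + hsE 0 u * hsE s v * hsE s φ) ^ 2 := by
  have hα₁' : 1 / 2 < α := by linarith
  set κ : ℤ → ℝ≥0∞ := fun m => ENNReal.ofReal (|(m : ℝ)| ^ (-(2 * α - 1))) with hκ
  set D : ℝ≥0∞ := ENNReal.ofReal (kernelConst α s) ^ 2 * ((∑' m, κ m ^ 2) ^ 2 * 9) with hD
  have hDtop : D ≠ ⊤ := by
    have := tsum_ofReal_abs_rpow_sq_ne_top (β := 2 * α - 1) (by linarith)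
    exact ENNReal.mul_ne_top (ENNReal.pow_ne_top ENNReal.ofReal_ne_top)
      (ENNReal.mul_ne_top (ENNReal.pow_ne_top this) (by norm_num))
  have hC0 : 0 ≤ kernelConst α s := by
    have : 0 < 2 * α - 1 := by linarith
    have : 0 < α := by linarith
    rw [kernelConst]; positivity
  refine ⟨D.toReal + 1, by positivity, fun N u v φ _ _ _ => ?_⟩
  have hterm : ∀ (n : ℤ) (p : ℤ × ℤ), ENNReal.ofReal ((1 + (n : ℝ) ^ 2) ^ (s / 2)) *
      (if res α p.1 p.2 (p.1 + p.2 - n) ≠ 0 ∧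
              inBall N p.1 ∧ inBall N p.2 ∧ inBall N (p.1 + p.2 - n) then
            ENNReal.ofReal (‖u p.1‖ * ‖v p.2‖ * ‖φ (p.1 + p.2 - n)‖ /
              (2 * |res α p.1 p.2 (p.1 + p.2 - n)|))
          else 0) ≤ ENNReal.ofReal (kernelConst α s) * ((κ (n - p.2) * κ (n - p.1)) *
        (ENNReal.ofReal (hsPairWeight s p.1 p.2 (p.1 + p.2 - n : ℤ)) *
          (‖u p.1‖ₑ * ‖v p.2‖ₑ * ‖φ (p.1 + p.2 - n)‖ₑ))) := fun n p => by
    split_ifs with h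
    · have hb := weight_div_res_le hα₁' hα₂ hs (n := n) (by ring) h.1
      have e1 : ((p.1 : ℝ) - (p.1 + p.2 - n : ℤ)) = ((n - p.2 : ℤ) : ℝ) := by push_cast; ring
      have e2 : ((p.2 : ℝ) - (p.1 + p.2 - n : ℤ)) = ((n - p.1 : ℤ) : ℝ) := by push_cast; ring
      rw [e1, e2] at hb
      simp only [hκ, ← ofReal_norm]
      rw [← ENNReal.ofReal_mul (by positivity), ← ENNReal.ofReal_mul (by positivity),
        ← ENNReal.ofReal_mul (by positivity), ← ENNReal.ofReal_mul (by positivity),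
        ← ENNReal.ofReal_mul' (by positivity), ← ENNReal.ofReal_mul (by positivity),
        ← ENNReal.ofReal_mul hC0]
      refine ENNReal.ofReal_le_ofReal ?_
      have := mul_le_mul_of_nonneg_right hb
        (by positivity : 0 ≤ ‖u p.1‖ * ‖v p.2‖ * ‖φ (p.1 + p.2 - n)‖)
      refine (le_of_eq ?_).trans (this.trans (le_of_eq ?_)) <;> ring
    · simp
  calc _ ≤ ∑' n : ℤ, ENNReal.ofReal (kernelConst α s) ^ 2 *
        (∑' p : ℤ × ℤ, (κ (n - p.2) * κ (n - p.1)) *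
          (ENNReal.ofReal (hsPairWeight s p.1 p.2 (p.1 + p.2 - n : ℤ)) *
            (‖u p.1‖ₑ * ‖v p.2‖ₑ * ‖φ (p.1 + p.2 - n)‖ₑ))) ^ 2 := by
        refine ENNReal.tsum_le_tsum fun n => ?_
        have hsq : ENNReal.ofReal ((1 + (n : ℝ) ^ 2) ^ s) =
            ENNReal.ofReal ((1 + (n : ℝ) ^ 2) ^ (s / 2)) ^ 2 := by
          rw [← ENNReal.ofReal_pow (by positivity), ← Real.rpow_mul_natCast (by positivity)]
          congr 2; push_cast; ring
        rw [hsq, ← mul_pow, ← mul_pow, ← ENNReal.tsum_mul_left, ← ENNReal.tsum_mul_left]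
        exact pow_le_pow_left' (ENNReal.tsum_le_tsum (hterm n)) 2
    _ ≤ D * (hsE s u * hsE s v * hsE 0 φ + hsE s u * hsE 0 v * hsE s φ
            + hsE 0 u * hsE s v * hsE s φ) ^ 2 := by
        rw [ENNReal.tsum_mul_left, hD, mul_assoc]
        gcongr
        exact tsum_sq_tsum_kernel_le s κ u v φ
    _ ≤ _ := by
        gcongr
        rw [ENNReal.le_ofReal_iff_toReal_le hDtop (by positivity)]
        linarith

end
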